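/- arXiv:1708.08846 — 5 statements merged into one kernel-verified Lean document; each statement's English description precedes it below -/
import Mathlib

section
/- Fix p > 2. There exists a unique R₀ ∈ (0,1) such that R₀^{(p−1)/2} + R₀^{−(p−1)/2} = (p−1)·(R₀^{1/2} + R₀^{−1/2}). Moreover, the function λ is decreasing on (−1, R₀) and increasing on (R₀, 1). -/
/-- φ(R) = R·|R|^{p-2}. -/
noncomputable def phi (p R : ℝ) : ℝ := R * |R| ^ (p - 2)

/-- The function λ from the paper. -/
noncomputable def lam (p R : ℝ) : ℝ :=
  if R = -1 then -(p - 2) / 2 else 1 / (1 + R) - (p - 1) / (1 + phi p R)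

open Set Real

lemma strictMonoOn_cosh_mul_sub {q : ℝ} (hq : 1 < q) :
    StrictMonoOn (fun s : ℝ => cosh (q * s) - q * cosh s) (Ici 0) := by
  have hd (s : ℝ) : HasDerivAt (fun s : ℝ => cosh (q * s) - q * cosh s)
      (sinh (q * s) * (q * 1) - q * sinh s) s :=
    ((hasDerivAt_id s).const_mul q).cosh.sub ((hasDerivAt_cosh s).const_mul q)
  refine strictMonoOn_of_deriv_pos (convex_Ici 0)
    (fun s _ => (hd s).continuousAt.continuousWithinAt) fun s hs => ?_
  rw [interior_Ici, mem_Ioi] at hs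
  rw [(hd s).deriv]
  have : sinh s < sinh (q * s) := sinh_lt_sinh.2 (by nlinarith)
  nlinarith

lemma mul_sinh_lt_sinh_mul {q s : ℝ} (hq : 1 < q) (hs : 0 < s) :
    q * sinh s < sinh (q * s) := by
  have hd (s : ℝ) : HasDerivAt (fun s : ℝ => sinh (q * s) - q * sinh s)
      (cosh (q * s) * (q * 1) - q * cosh s) s :=
    ((hasDerivAt_id s).const_mul q).sinh.sub ((hasDerivAt_sinh s).const_mul q)
  have hmono : StrictMonoOn (fun s : ℝ => sinh (q * s) - q * sinh s) (Ici 0) := by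
    refine strictMonoOn_of_deriv_pos (convex_Ici 0)
      (fun s _ => (hd s).continuousAt.continuousWithinAt) fun s hs => ?_
    rw [interior_Ici, mem_Ioi] at hs
    rw [(hd s).deriv]
    have : cosh s < cosh (q * s) := by
      rw [cosh_lt_cosh, abs_of_pos hs, abs_of_pos (by positivity)]
      nlinarith
    nlinarith
  have := hmono self_mem_Ici (mem_Ici.2 hs.le) hs
  simp only [mul_zero, sinh_zero, sub_zero] at this
  linarith

lemma exists_cosh_mul_eq {q : ℝ} (hq : 1 < q) : ∃ s, 0 < s ∧ cosh (q * s) = q * cosh s := by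
  have hq' : 0 < q - 1 := sub_pos.2 hq
  set S := log (2 * q) / (q - 1) with hS
  have hS0 : 0 < S := div_pos (log_pos (by linarith)) hq'
  have hexp : exp (q * S) = 2 * q * exp S := by
    rw [show q * S = log (2 * q) + S by rw [hS]; field_simp; ring, exp_add,
      exp_log (by linarith)]
  have hpos : 0 ≤ cosh (q * S) - q * cosh S := by
    have h1 : exp (-S) ≤ exp S := exp_le_exp.2 (by linarith)
    have h2 := exp_pos (-(q * S))
    rw [cosh_eq, cosh_eq, hexp]
    nlinarith
  obtain ⟨s, hs, h⟩ := intermediate_value_Icc (f := fun s => cosh (q * s) - q * cosh s) hS0.le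
    (by fun_prop) (show (0 : ℝ) ∈ Icc _ _ from ⟨by simp; linarith, hpos⟩)
  refine ⟨s, lt_of_le_of_ne hs.1 ?_, by simpa [sub_eq_zero] using h⟩
  rintro rfl
  simp at h
  linarith

lemma rpow_add_rpow_neg_eq_cosh {R : ℝ} (hR : 0 < R) (x : ℝ) :
    R ^ x + R ^ (-x) = 2 * cosh (2 * x * (-log R / 2)) := by
  rw [rpow_def_of_pos hR, rpow_def_of_pos hR, cosh_eq]
  ring_nf

lemma rpow_balance_iff {p R : ℝ} (hR : 0 < R) :
    R ^ ((p - 1) / 2) + R ^ (-((p - 1) / 2))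
      = (p - 1) * (R ^ ((1 : ℝ) / 2) + R ^ (-(1 : ℝ) / 2)) ↔
    cosh ((p - 1) * (-log R / 2)) = (p - 1) * cosh (-log R / 2) := by
  rw [neg_div (2 : ℝ) 1, rpow_add_rpow_neg_eq_cosh hR, rpow_add_rpow_neg_eq_cosh hR,
    mul_div_cancel₀ _ (two_ne_zero' ℝ), mul_div_cancel₀ _ (two_ne_zero' ℝ), one_mul]
  constructor <;> intro h <;> linarith

lemma one_add_rpow_eq {r : ℝ} (hr : 0 < r) (q : ℝ) :
    1 + r ^ q = 2 * r ^ (q / 2) * cosh (q * (-log r / 2)) := by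
  have h : r ^ q = r ^ (q / 2) * r ^ (q / 2) := by rw [← rpow_add hr]; ring_nf
  have h1 : r ^ (q / 2) * r ^ (-(q / 2)) = 1 := by rw [← rpow_add hr]; simp
  have h2 := rpow_add_rpow_neg_eq_cosh hr (q / 2)
  rw [mul_div_cancel₀ _ (two_ne_zero' ℝ)] at h2
  linear_combination h - h1 + r ^ (q / 2) * h2

lemma one_sub_rpow_eq {r : ℝ} (hr : 0 < r) (q : ℝ) :
    1 - r ^ q = 2 * r ^ (q / 2) * sinh (q * (-log r / 2)) := by
  have h : r ^ q = r ^ (q / 2) * r ^ (q / 2) := by rw [← rpow_add hr]; ring_nf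
  have h1 : r ^ (q / 2) * r ^ (-(q / 2)) = 1 := by rw [← rpow_add hr]; simp
  have h2 : r ^ (-(q / 2)) - r ^ (q / 2) = 2 * sinh (q * (-log r / 2)) := by
    rw [rpow_def_of_pos hr, rpow_def_of_pos hr, sinh_eq]
    ring_nf
  linear_combination -h - h1 + r ^ (q / 2) * h2

lemma rpow_half_mul_rpow_half {r : ℝ} (hr : 0 < r) (q : ℝ) :
    r ^ ((q - 1) / 2) * r ^ ((1 : ℝ) / 2) = r ^ (q / 2) := by
  rw [← rpow_add hr]; ring_nf

lemma sq_rpow_half {r : ℝ} (hr : 0 < r) (x : ℝ) : (r ^ (x / 2)) ^ 2 = r ^ x := by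
  rw [sq, ← rpow_add hr]; ring_nf

lemma mul_rpow_mul_one_sub_lt {q r : ℝ} (hq : 1 < q) (hr : r ∈ Ioo (0 : ℝ) 1) :
    q * r ^ ((q - 1) / 2) * (1 - r) < 1 - r ^ q := by
  have h1 := one_sub_rpow_eq hr.1 1
  rw [rpow_one, one_mul] at h1
  rw [h1, one_sub_rpow_eq hr.1 q, ← rpow_half_mul_rpow_half hr.1 q]
  have hs := mul_sinh_lt_sinh_mul hq (show 0 < -log r / 2 by linarith [log_neg hr.1 hr.2])
  have : 0 < r ^ ((q - 1) / 2) * r ^ ((1 : ℝ) / 2) :=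
    mul_pos (rpow_pos_of_pos hr.1 _) (rpow_pos_of_pos hr.1 _)
  nlinarith

lemma one_add_rpow_sub_mul_rpow_mul_one_add {q r : ℝ} (hr : 0 < r) :
    1 + r ^ q - q * r ^ ((q - 1) / 2) * (1 + r)
      = 2 * r ^ (q / 2) * (cosh (q * (-log r / 2)) - q * cosh (-log r / 2)) := by
  have h1 := one_add_rpow_eq hr 1
  rw [rpow_one, one_mul] at h1
  rw [h1, one_add_rpow_eq hr q, ← rpow_half_mul_rpow_half hr q]
  ring

lemma strictMonoOn_inv_one_sub_sub {q : ℝ} (hq : 1 < q) :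
    StrictMonoOn (fun r : ℝ => 1 / (1 - r) - q / (1 - r ^ q)) (Ico 0 1) := by
  have hd {r : ℝ} (hr : r ∈ Ico (0 : ℝ) 1) :
      HasDerivAt (fun r : ℝ => 1 / (1 - r) - q / (1 - r ^ q))
        (1 / (1 - r) ^ 2 - q ^ 2 * r ^ (q - 1) / (1 - r ^ q) ^ 2) r := by
    have h1 : 1 - r ≠ 0 := by linarith [hr.2]
    have h2 : 1 - r ^ q ≠ 0 := by linarith [rpow_lt_one hr.1 hr.2 (by linarith : 0 < q)]
    refine (((hasDerivAt_const r (1 : ℝ)).div ((hasDerivAt_id' r).const_sub 1) h1).sub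
      ((hasDerivAt_const r q).div ((hasDerivAt_rpow_const (Or.inr hq.le)).const_sub 1)
        h2)).congr_deriv ?_
    ring
  refine strictMonoOn_of_deriv_pos (convex_Ico 0 1)
    (fun r hr => (hd hr).continuousAt.continuousWithinAt) fun r hr => ?_
  rw [interior_Ico] at hr
  rw [(hd ⟨hr.1.le, hr.2⟩).deriv, ← sq_rpow_half hr.1 (q - 1), ← mul_pow, sub_pos]
  have h1 : 0 < 1 - r := by linarith [hr.2]
  have h2 : 0 < 1 - r ^ q := by linarith [rpow_lt_one hr.1.le hr.2 (by linarith : 0 < q)]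
  have h3 : 0 < r ^ ((q - 1) / 2) := rpow_pos_of_pos hr.1 _
  rw [div_lt_div_iff₀ (by positivity) (by positivity), ← mul_pow, one_mul]
  exact pow_lt_pow_left₀ (mul_rpow_mul_one_sub_lt hq hr) (by positivity) two_ne_zero

lemma hasDerivAt_inv_one_add_sub {q r : ℝ} (hq : 1 < q) (hr : 0 ≤ r) :
    HasDerivAt (fun r : ℝ => 1 / (1 + r) - q / (1 + r ^ q))
      (q ^ 2 * r ^ (q - 1) / (1 + r ^ q) ^ 2 - 1 / (1 + r) ^ 2) r := by
  have h1 : 1 + r ≠ 0 := by positivity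
  have h2 : 1 + r ^ q ≠ 0 := by positivity
  refine (((hasDerivAt_const r (1 : ℝ)).div ((hasDerivAt_id' r).const_add 1) h1).sub
    ((hasDerivAt_const r q).div ((hasDerivAt_rpow_const (Or.inr hq.le)).const_add 1)
      h2)).congr_deriv ?_
  ring

lemma deriv_inv_one_add_sub_neg {q r : ℝ} (hq : 1 < q) (hr : 0 < r)
    (h : q * cosh (-log r / 2) < cosh (q * (-log r / 2))) :
    deriv (fun r : ℝ => 1 / (1 + r) - q / (1 + r ^ q)) r < 0 := by
  rw [(hasDerivAt_inv_one_add_sub hq hr.le).deriv, ← sq_rpow_half hr (q - 1), ← mul_pow, sub_neg,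
    div_lt_div_iff₀ (by positivity) (by positivity), ← mul_pow, one_mul]
  refine pow_lt_pow_left₀ (sub_pos.1 ?_) (by positivity) two_ne_zero
  rw [one_add_rpow_sub_mul_rpow_mul_one_add hr]
  exact mul_pos (by positivity) (sub_pos.2 h)

lemma deriv_inv_one_add_sub_pos {q r : ℝ} (hq : 1 < q) (hr : 0 < r)
    (h : cosh (q * (-log r / 2)) < q * cosh (-log r / 2)) :
    0 < deriv (fun r : ℝ => 1 / (1 + r) - q / (1 + r ^ q)) r := by
  rw [(hasDerivAt_inv_one_add_sub hq hr.le).deriv, ← sq_rpow_half hr (q - 1), ← mul_pow, sub_pos,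
    div_lt_div_iff₀ (by positivity) (by positivity), ← mul_pow, one_mul]
  refine pow_lt_pow_left₀ (sub_neg.1 ?_) (by positivity) two_ne_zero
  rw [one_add_rpow_sub_mul_rpow_mul_one_add hr]
  exact mul_neg_of_pos_of_neg (by positivity) (sub_neg.2 h)

lemma mul_rpow_sub_two {p r : ℝ} (hp : 2 < p) (hr : 0 ≤ r) :
    r * r ^ (p - 2) = r ^ (p - 1) := by
  rw [show p - 1 = 1 + (p - 2) by ring, rpow_add_of_nonneg hr zero_le_one (by linarith), rpow_one]

lemma lam_of_nonneg {p r : ℝ} (hp : 2 < p) (hr : 0 ≤ r) :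
    lam p r = 1 / (1 + r) - (p - 1) / (1 + r ^ (p - 1)) := by
  rw [lam, if_neg (by linarith), phi, abs_of_nonneg hr, mul_rpow_sub_two hp hr]

lemma lam_neg {p r : ℝ} (hp : 2 < p) (hr : 0 ≤ r) (hr1 : r < 1) :
    lam p (-r) = 1 / (1 - r) - (p - 1) / (1 - r ^ (p - 1)) := by
  rw [lam, if_neg (by linarith), phi, abs_neg, abs_of_nonneg hr, neg_mul,
    mul_rpow_sub_two hp hr, ← sub_eq_add_neg, ← sub_eq_add_neg]

lemma strictAntiOn_lam_Ioc {p : ℝ} (hp : 2 < p) : StrictAntiOn (lam p) (Ioc (-1) 0) := by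
  intro x hx y hy hxy
  have h := strictMonoOn_inv_one_sub_sub (show 1 < p - 1 by linarith)
    (show -y ∈ Ico (0 : ℝ) 1 from ⟨by linarith [hy.2], by linarith [hy.1]⟩)
    (show -x ∈ Ico (0 : ℝ) 1 from ⟨by linarith [hx.2], by linarith [hx.1]⟩) (neg_lt_neg hxy)
  dsimp only at h
  rwa [← lam_neg hp (by linarith [hy.2]) (by linarith [hy.1]),
    ← lam_neg hp (by linarith [hx.2]) (by linarith [hx.1]), neg_neg, neg_neg] at h

theorem R0_exists_unique_and_lam_monotone (p : ℝ) (hp : 2 < p) :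
    (∃! R₀ : ℝ, R₀ ∈ Set.Ioo (0 : ℝ) 1 ∧
      R₀ ^ ((p - 1) / 2) + R₀ ^ (-((p - 1) / 2))
        = (p - 1) * (R₀ ^ ((1 : ℝ) / 2) + R₀ ^ (-(1 : ℝ) / 2))) ∧
    (∀ R₀ : ℝ, R₀ ∈ Set.Ioo (0 : ℝ) 1 →
      R₀ ^ ((p - 1) / 2) + R₀ ^ (-((p - 1) / 2))
        = (p - 1) * (R₀ ^ ((1 : ℝ) / 2) + R₀ ^ (-(1 : ℝ) / 2)) →
      StrictAntiOn (lam p) (Set.Ioo (-1 : ℝ) R₀) ∧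
      StrictMonoOn (lam p) (Set.Ioo R₀ 1)) := by
  have hq : 1 < p - 1 := by linarith
  have hmono := strictMonoOn_cosh_mul_sub hq
  refine ⟨?_, fun R₀ hR₀ h => ?_⟩
  · obtain ⟨s, hs, h⟩ := exists_cosh_mul_eq hq
    have hlog : -log (exp (-(2 * s))) / 2 = s := by rw [log_exp]; ring
    refine ⟨exp (-(2 * s)), ⟨⟨exp_pos _, exp_lt_one_iff.2 (by linarith)⟩, ?_⟩, ?_⟩
    · rw [rpow_balance_iff (exp_pos _), hlog, h]
    · rintro R ⟨hR, hR'⟩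
      rw [rpow_balance_iff hR.1] at hR'
      have : -log R / 2 = s := hmono.injOn
        (mem_Ici.2 (by linarith [log_neg hR.1 hR.2])) (mem_Ici.2 hs.le)
        (by simp only [hR', h, sub_self])
      rw [← this, show -(2 * (-log R / 2)) = log R by ring, exp_log hR.1]
  · rw [rpow_balance_iff hR₀.1] at h
    have h0 : 0 ≤ -log R₀ / 2 := by linarith [log_neg hR₀.1 hR₀.2]
    constructor
    · have hanti : StrictAntiOn (lam p) (Ico 0 R₀) := by
        refine StrictAntiOn.congr (strictAntiOn_of_deriv_neg (convex_Ico 0 R₀) (fun r hr =>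
          (hasDerivAt_inv_one_add_sub hq hr.1).continuousAt.continuousWithinAt) fun r hr => ?_)
          fun r hr => (lam_of_nonneg hp hr.1).symm
        rw [interior_Ico] at hr
        have hlog := log_lt_log hr.1 hr.2
        have := hmono (mem_Ici.2 h0) (mem_Ici.2 (by linarith))
          (show -log R₀ / 2 < -log r / 2 by linarith)
        dsimp only at this
        exact deriv_inv_one_add_sub_neg hq hr.1 (by linarith)
      rw [← Ioc_union_Ico_eq_Ioo (show (-1 : ℝ) < 0 by norm_num) hR₀.1]
      exact (strictAntiOn_lam_Ioc hp).union hanti (isGreatest_Ioc (by norm_num))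
        (isLeast_Ico hR₀.1)
    · refine StrictMonoOn.congr (strictMonoOn_of_deriv_pos (convex_Ioo R₀ 1) (fun r hr =>
        (hasDerivAt_inv_one_add_sub hq (hR₀.1.trans hr.1).le).continuousAt.continuousWithinAt)
        fun r hr => ?_) fun r hr => (lam_of_nonneg hp (hR₀.1.trans hr.1).le).symm
      rw [interior_Ioo] at hr
      have hr0 := hR₀.1.trans hr.1
      have hlog := log_lt_log hR₀.1 hr.1
      have := hmono (mem_Ici.2 (by linarith [log_neg hr0 hr.2])) (mem_Ici.2 h0)
        (show -log r / 2 < -log R₀ / 2 by linarith)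
      dsimp only at this
      exact deriv_inv_one_add_sub_pos hq hr0 (by linarith)
end

section
/- Fix p > 2 and q = p/(p−1). For any R ∈ [−1,1] and any a₁, a₂ ∈ ℝ with a₁a₂ > 0, the Bellman function B_{c,+} (with θ = p, θ' = q) is linear on the segment ℓ_c(a₁,a₂,R) joining a = (a₁, a₂, |a₁|^p, |a₂|^q) and b = (−ρ(R)a₁, −φ(R)a₂, |ρ(R)a₁|^p, |R|^p|a₂|^q); explicitly, for all τ ∈ [0,1], B_{c,+}(τa + (1−τ)b) = a₁a₂·(τ + (1−τ)ρ(R)φ(R)). Moreover, if R ∈ [R₀,1], then B_{c,+}(x) = x₃^{1/p}·x₄^{1/q} for every x on this segment. -/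
open MeasureTheory

noncomputable def mu : Measure ℝ := volume.restrict (Set.Icc 0 1)

/-- The Bellman function B_{c,+} for the exponent θ (with dual exponent θ/(θ-1)). -/
noncomputable def Bc (θ : ℝ) (x₁ x₂ x₃ x₄ : ℝ) : ℝ :=
  sSup {y : ℝ | ∃ f g : ℝ → ℝ,
    Integrable f mu ∧ Integrable g mu ∧ Integrable (fun t => f t * g t) mu ∧
    Integrable (fun t => |f t| ^ θ) mu ∧
    Integrable (fun t => |g t| ^ (θ / (θ - 1))) mu ∧
    (∫ t, f t ∂mu) = x₁ ∧ (∫ t, g t ∂mu) = x₂ ∧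
    (∫ t, |f t| ^ θ ∂mu) = x₃ ∧ (∫ t, |g t| ^ (θ / (θ - 1)) ∂mu) = x₄ ∧
    y = ∫ t, f t * g t ∂mu}

section Convexity

variable {G H K : ℝ → ℝ} {r₁ r₂ m n : ℝ}

/-- A function that is convex, then concave, then strictly convex, and has two critical zeros
`m < r₂ < n`, is nonnegative. -/
theorem nonneg_of_convex_concave_convex
    (hG : ∀ x, HasDerivAt G (H x) x) (hH : ∀ x, HasDerivAt H (K x) x)
    (hK₁ : ∀ x < r₁, 0 ≤ K x) (hK₂ : ∀ x ∈ Set.Ioo r₁ r₂, K x ≤ 0) (hK₃ : ∀ x > r₂, 0 < K x)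
    (hm : m < r₂) (hn : r₂ < n) (hGm : G m = 0) (hGn : G n = 0) (hHm : H m = 0) (hHn : H n = 0)
    (x : ℝ) : 0 ≤ G x := by
  have cG : Continuous G := continuous_iff_continuousAt.2 fun x => (hG x).continuousAt
  have cH : Continuous H := continuous_iff_continuousAt.2 fun x => (hH x).continuousAt
  have dG : Differentiable ℝ G := fun x => (hG x).differentiableAt
  have dH : Differentiable ℝ H := fun x => (hH x).differentiableAt
  have eG : deriv G = H := funext fun x => (hG x).deriv
  have eH : deriv H = K := funext fun x => (hH x).deriv
  have mH₁ : MonotoneOn H (Set.Iic r₁) :=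
    monotoneOn_of_deriv_nonneg (convex_Iic _) cH.continuousOn dH.differentiableOn
      (by simpa [eH] using hK₁)
  have mH₂ : AntitoneOn H (Set.Icc r₁ r₂) :=
    antitoneOn_of_deriv_nonpos (convex_Icc _ _) cH.continuousOn dH.differentiableOn
      (by simpa [eH] using hK₂)
  have mH₃ : StrictMonoOn H (Set.Ici r₂) :=
    strictMonoOn_of_deriv_pos (convex_Ici _) cH.continuousOn (by simpa [eH] using hK₃)
  have aG : StrictAntiOn G (Set.Icc r₂ n) := by
    refine strictAntiOn_of_deriv_neg (convex_Icc _ _) cG.continuousOn fun y hy => ?_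
    rw [interior_Icc] at hy
    rw [eG, ← hHn]
    exact mH₃ hy.1.le hn.le hy.2
  have bG : MonotoneOn G (Set.Ici n) := by
    refine monotoneOn_of_deriv_nonneg (convex_Ici _) cG.continuousOn dG.differentiableOn
      fun y hy => ?_
    rw [interior_Ici] at hy
    have hy' : n < y := hy
    rw [eG, ← hHn]
    exact (mH₃ hn.le (hn.trans hy').le hy').le
  have hr₂ : 0 < G r₂ := by
    rw [← hGn]; exact aG ⟨le_rfl, hn.le⟩ ⟨hn.le, le_rfl⟩ hn
  have right : ∀ y, r₂ ≤ y → 0 ≤ G y := by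
    intro y hy
    rw [← hGn]
    rcases le_total y n with h | h
    · exact aG.antitoneOn ⟨hy, h⟩ ⟨hn.le, le_rfl⟩ h
    · exact bG (Set.mem_Ici.2 le_rfl) (Set.mem_Ici.2 h) h
  have hmr : m ≤ r₁ := by
    by_contra! h
    have : AntitoneOn G (Set.Icc m r₂) := by
      refine antitoneOn_of_deriv_nonpos (convex_Icc _ _) cG.continuousOn dG.differentiableOn
        fun y hy => ?_
      rw [interior_Icc] at hy
      rw [eG, ← hHm]
      exact mH₂ ⟨h.le, hm.le⟩ ⟨h.le.trans hy.1.le, hy.2.le⟩ hy.1.le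
    have := this ⟨le_rfl, hm.le⟩ ⟨hm.le, le_rfl⟩ hm.le
    linarith
  have left : ∀ y ≤ r₁, 0 ≤ G y := by
    intro y hy
    rw [← hGm]
    rcases le_total y m with h | h
    · have : AntitoneOn G (Set.Iic m) := by
        refine antitoneOn_of_deriv_nonpos (convex_Iic _) cG.continuousOn dG.differentiableOn
          fun z hz => ?_
        rw [interior_Iic] at hz
        have hz' : z < m := hz
        rw [eG, ← hHm]
        exact mH₁ (hz'.le.trans hmr) hmr hz'.le
      exact this (Set.mem_Iic.2 h) (Set.mem_Iic.2 le_rfl) h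
    · have : MonotoneOn G (Set.Icc m r₁) := by
        refine monotoneOn_of_deriv_nonneg (convex_Icc _ _) cG.continuousOn dG.differentiableOn
          fun z hz => ?_
        rw [interior_Icc] at hz
        rw [eG, ← hHm]
        exact mH₁ hmr hz.2.le hz.1.le
      exact this ⟨le_rfl, hmr⟩ ⟨h, hy⟩ h
  rcases le_total x r₁ with h₁ | h₁
  · exact left x h₁
  rcases le_total r₂ x with h₂ | h₂
  · exact right x h₂
  have hc : ConcaveOn ℝ (Set.Icc r₁ r₂) G := by
    refine AntitoneOn.concaveOn_of_deriv (convex_Icc _ _) cG.continuousOn dG.differentiableOn ?_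
    rw [eG]
    exact mH₂.mono interior_subset
  have h := hc.min_le_of_mem_Icc ⟨le_rfl, h₁.trans h₂⟩ ⟨h₁.trans h₂, le_rfl⟩ ⟨h₁, h₂⟩
  exact (le_min (left r₁ le_rfl) hr₂.le).trans h

end Convexity

section Power

variable {p : ℝ}

theorem hasDerivAt_phi (hp : 2 < p) (x : ℝ) :
    HasDerivAt (phi p) ((p - 1) * |x| ^ (p - 2)) x := by
  rcases eq_or_ne x 0 with rfl | hx
  · rw [hasDerivAt_iff_tendsto_slope]
    have hc : Filter.Tendsto (fun y : ℝ => |y| ^ (p - 2)) (nhdsWithin 0 {0}ᶜ)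
        (nhds ((p - 1) * |(0 : ℝ)| ^ (p - 2))) := by
      have : Continuous fun y : ℝ => |y| ^ (p - 2) :=
        continuous_abs.rpow_const fun _ => Or.inr (by linarith)
      have h := (this.tendsto 0).mono_left (nhdsWithin_le_nhds (s := {0}ᶜ))
      simpa [Real.zero_rpow (by linarith : p - 2 ≠ 0)] using h
    refine hc.congr' ?_
    filter_upwards [self_mem_nhdsWithin] with y hy
    have hy' : y ≠ 0 := hy
    simp [slope_def_field, phi, hy']
  · have habs : HasDerivAt (fun y : ℝ => |y|) (SignType.sign x : ℝ) x := hasDerivAt_abs hx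
    have h := (hasDerivAt_id x).mul (habs.rpow_const (p := p - 2) (Or.inl (abs_ne_zero.2 hx)))
    have h₁ : |x| ^ (p - 2 - 1) * |x| = |x| ^ (p - 2) := by
      rw [← Real.rpow_add_one (abs_ne_zero.2 hx)]; ring_nf
    have h₂ : x * (SignType.sign x : ℝ) = |x| := self_mul_sign x
    refine HasDerivAt.congr_deriv (f := phi p) h ?_
    simp only [id]
    linear_combination (p - 2) * h₁ + (p - 2) * |x| ^ (p - 2 - 1) * h₂

theorem hasDerivAt_abs_rpow_div (hp : 2 < p) (x : ℝ) :
    HasDerivAt (fun x => |x| ^ p / p) (phi p x) x := by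
  refine ((hasDerivAt_abs_rpow x (by linarith : 1 < p)).div_const p).congr_deriv ?_
  rw [phi]; field_simp

theorem mul_phi (hp : 2 < p) (x : ℝ) : x * phi p x = |x| ^ p := by
  rcases eq_or_ne x 0 with rfl | hx
  · simp [phi, Real.zero_rpow (by linarith : p ≠ 0)]
  · have h : |x| ^ p = |x| ^ (p - 2) * |x| ^ (2 : ℝ) := by
      rw [← Real.rpow_add (abs_pos.2 hx)]; ring_nf
    rw [h, phi, Real.rpow_two, sq_abs]; ring

theorem abs_phi_rpow (hp : 2 < p) (x : ℝ) : |phi p x| ^ (p / (p - 1)) = |x| ^ p := by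
  have h : |phi p x| = |x| ^ (p - 1) := by
    rcases eq_or_ne x 0 with rfl | hx
    · simp [phi, Real.zero_rpow (by linarith : p - 1 ≠ 0)]
    · rw [phi, abs_mul, abs_of_nonneg (Real.rpow_nonneg (abs_nonneg x) _), mul_comm,
        ← Real.rpow_add_one (abs_ne_zero.2 hx)]
      ring_nf
  rw [h, ← Real.rpow_mul (abs_nonneg x)]
  congr 1
  have : p - 1 ≠ 0 := by linarith
  field_simp

theorem phi_neg (x : ℝ) : phi p (-x) = -phi p x := by simp [phi]

theorem phi_one : phi p 1 = 1 := by simp [phi]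

theorem neg_one_lt_phi (hp : 2 < p) {x : ℝ} (hx : -1 < x) : -1 < phi p x := by
  rcases le_total 0 x with h | h
  · have : 0 ≤ phi p x := mul_nonneg h (Real.rpow_nonneg (abs_nonneg x) _)
    linarith
  · have h₁ : |x| ≤ 1 := abs_le.2 ⟨hx.le, by linarith⟩
    have h₂ : |x| ^ (p - 2) ≤ 1 := Real.rpow_le_one (abs_nonneg x) h₁ (by linarith)
    rw [phi]; nlinarith

theorem phi_le_self (hp : 2 < p) {x : ℝ} (h₀ : 0 ≤ x) (h₁ : x ≤ 1) : phi p x ≤ x := by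
  have : |x| ^ (p - 2) ≤ 1 :=
    Real.rpow_le_one (abs_nonneg x) (by rwa [abs_of_nonneg h₀]) (by linarith)
  rw [phi]; nlinarith

/-- Equal values of `λ` at `R < ρ` force `(1 + φ) / (1 + id)` to be larger at `R`. -/
theorem one_add_phi_cross_lt (hp : 2 < p) {R r : ℝ} (hR : -1 < R) (hRr : R < r)
    (hr₀ : 0 < r) (hr₁ : r ≤ 1) (hlam : lam p r = lam p R) :
    (1 + R) * (1 + phi p r) < (1 + r) * (1 + phi p R) := by
  rw [lam, lam, if_neg (by linarith), if_neg (by linarith)] at hlam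
  have hX : 0 < 1 + R := by linarith
  have hX' : 0 < 1 + r := by linarith
  have hY : 0 < 1 + phi p R := by linarith [neg_one_lt_phi hp hR]
  have hY' : 0 < 1 + phi p r := by linarith [neg_one_lt_phi hp (hR.trans hRr)]
  have hYX : 1 + phi p r ≤ 1 + r := by linarith [phi_le_self hp hr₀.le hr₁]
  generalize 1 + phi p R = Y at *
  generalize 1 + phi p r = Y' at *
  have hneg : 1 / (1 + r) - (p - 1) / Y' < 0 := by
    rw [sub_neg, div_lt_div_iff₀ hX' hY']
    nlinarith
  have h₁ : (p - 1) * ((1 + R) / Y) < (p - 1) * ((1 + r) / Y') := by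
    have e₁ : (p - 1) * ((1 + R) / Y) = 1 - (1 + R) * (1 / (1 + R) - (p - 1) / Y) := by
      field_simp; ring
    have e₂ : (p - 1) * ((1 + r) / Y') = 1 - (1 + r) * (1 / (1 + r) - (p - 1) / Y') := by
      field_simp; ring
    rw [e₁, e₂, ← hlam]
    nlinarith
  have h₂ := lt_of_mul_lt_mul_left h₁ (by linarith)
  rwa [div_lt_div_iff₀ hY hY'] at h₂

end Power

section Majorant

variable {p : ℝ}

/-- Nonnegativity of the gap function obtained by minimising over the second variable. -/
theorem reduced_gap_nonneg (hp : 2 < p) {R r A D : ℝ} (hR : -1 < R) (hRr : R < r)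
    (hr₀ : 0 < r) (hr₁ : r ≤ 1) (hlam : lam p r = lam p R)
    (hA : A = (1 + phi p R) / (1 + phi p r)) (hD : D = (1 + r) / (1 + R)) (x : ℝ) :
    0 ≤ -1 + A * (1 - 1 / p) + D / p + (1 - A) * x + A * (|x| ^ p / p)
      - D * (|(x + D - 1) / D| ^ p / p) := by
  have hX : 0 < 1 + R := by linarith
  have hX' : 0 < 1 + r := by linarith
  have hY : 0 < 1 + phi p R := by linarith [neg_one_lt_phi hp hR]
  have hY' : 0 < 1 + phi p r := by linarith [neg_one_lt_phi hp (hR.trans hRr)]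
  have hp₀ : 0 < p := by linarith
  have hp₂ : 0 < p - 2 := by linarith
  have hD₁ : 1 < D := by rw [hD, one_lt_div hX]; linarith
  have hD₀ : 0 < D := by linarith
  have hA₀ : 0 < A := by rw [hA]; positivity
  have hAD : 1 < A * D := by
    rw [hA, hD, div_mul_div_comm, one_lt_div (by positivity)]
    linarith [one_add_phi_cross_lt hp hR hRr hr₀ hr₁ hlam]
  have hu : ∀ y, HasDerivAt (fun y : ℝ => (y + D - 1) / D) (1 / D) y := fun y =>
    (((hasDerivAt_id y).add_const D).sub_const 1).div_const D
  have hur : (-r + D - 1) / D = -R := by rw [hD]; field_simp; ring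
  have hu₁ : (1 + D - 1) / D = 1 := by field_simp; ring
  set k : ℝ := (A * D) ^ (1 / (p - 2)) with hk
  have hk₁ : 1 < k := Real.one_lt_rpow hAD (by positivity)
  have hk₀ : 0 < k := by linarith
  have hkp : k ^ (p - 2) = A * D := by
    rw [hk, ← Real.rpow_mul (by positivity), one_div_mul_cancel hp₂.ne', Real.rpow_one]
  have hkD : 1 < k * D := by nlinarith
  have hscale : ∀ y : ℝ, A * ((p - 1) * |y| ^ (p - 2))
      - (p - 1) * |(y + D - 1) / D| ^ (p - 2) * (1 / D)
      = (p - 1) / D * (|k * y| ^ (p - 2) - |(y + D - 1) / D| ^ (p - 2)) := by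
    intro y
    rw [abs_mul, abs_of_pos hk₀, Real.mul_rpow hk₀.le (abs_nonneg y), hkp]
    field_simp
  have hc : 0 < (p - 1) / D := div_pos (by linarith) hD₀
  refine nonneg_of_convex_concave_convex
    (G := fun y => -1 + A * (1 - 1 / p) + D / p + (1 - A) * y + A * (|y| ^ p / p)
      - D * (|(y + D - 1) / D| ^ p / p))
    (H := fun y => 1 - A + A * phi p y - phi p ((y + D - 1) / D))
    (K := fun y => A * ((p - 1) * |y| ^ (p - 2))
      - (p - 1) * |(y + D - 1) / D| ^ (p - 2) * (1 / D))
    (r₁ := -(D - 1) / (k * D + 1)) (r₂ := (D - 1) / (k * D - 1)) (m := -r) (n := 1)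
    ?_ ?_ ?_ ?_ ?_ ?_ ?_ ?_ ?_ ?_ ?_ x
  · intro y
    have h := ((((hasDerivAt_id y).const_mul (1 - A)).const_add
      (-1 + A * (1 - 1 / p) + D / p)).add ((hasDerivAt_abs_rpow_div hp y).const_mul A)).sub
      (((hasDerivAt_abs_rpow_div hp ((y + D - 1) / D)).comp y (hu y)).const_mul D)
    refine h.congr_deriv ?_
    field_simp
  · intro y
    have h : HasDerivAt (fun y => phi p ((y + D - 1) / D))
        ((p - 1) * |(y + D - 1) / D| ^ (p - 2) * (1 / D)) y :=
      HasDerivAt.comp (h₂ := phi p) y (hasDerivAt_phi hp ((y + D - 1) / D)) (hu y)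
    exact (((hasDerivAt_phi hp y).const_mul A).const_add (1 - A)).sub h
  · intro y hy
    rw [lt_div_iff₀ (by linarith)] at hy
    rw [hscale]
    refine mul_nonneg hc.le (sub_nonneg.2 (Real.rpow_le_rpow (abs_nonneg _) ?_ hp₂.le))
    have hy0 : y < 0 := by nlinarith
    rw [abs_of_neg (by nlinarith : k * y < 0), abs_le]
    constructor
    · rw [le_div_iff₀ hD₀]; nlinarith
    · rw [div_le_iff₀ hD₀]; nlinarith
  · rintro y ⟨hy₁, hy₂⟩
    rw [div_lt_iff₀ (by linarith)] at hy₁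
    rw [lt_div_iff₀ (by linarith)] at hy₂
    rw [hscale]
    refine mul_nonpos_of_nonneg_of_nonpos hc.le
      (sub_nonpos.2 (Real.rpow_le_rpow (abs_nonneg _) ?_ hp₂.le))
    refine le_trans ?_ (le_abs_self _)
    rw [abs_le]
    constructor
    · rw [← neg_le_neg_iff, neg_neg, ← sub_nonneg]
      have : (y + D - 1) / D - -(k * y) = (y + D - 1 + k * y * D) / D := by field_simp; ring
      have h2 : 0 ≤ (y + D - 1) / D - -(k * y) := by
        rw [this]; exact div_nonneg (by linarith) hD₀.le
      linarith
    · rw [le_div_iff₀ hD₀]; linarith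
  · intro y hy
    have hr₂ : 0 < (D - 1) / (k * D - 1) := div_pos (by linarith) (by linarith)
    have hy0 : 0 < y := hr₂.trans hy
    rw [gt_iff_lt, div_lt_iff₀ (by linarith)] at hy
    rw [hscale]
    refine mul_pos hc (sub_pos.2 (Real.rpow_lt_rpow (abs_nonneg _) ?_ hp₂))
    rw [abs_of_pos (by positivity : 0 < k * y), abs_of_pos (div_pos (by linarith) hD₀),
      div_lt_iff₀ hD₀]
    linarith
  · have : 0 < (D - 1) / (k * D - 1) := div_pos (by linarith) (by linarith)
    linarith
  · rw [div_lt_one (by linarith)]; nlinarith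
  · simp only [hur, abs_neg, ← mul_phi hp]
    have : ∀ a b : ℝ, 0 < 1 + a → 0 < 1 + b →
        -1 + (1 + b) / (1 + a) * (1 - 1 / p) + (1 + r) / (1 + R) / p
          + (1 - (1 + b) / (1 + a)) * -r + (1 + b) / (1 + a) * (r * a / p)
          - (1 + r) / (1 + R) * (R * b / p)
        = (1 + r) * (1 + b) / p
          * (1 / (1 + R) - (p - 1) / (1 + b) - (1 / (1 + r) - (p - 1) / (1 + a))) := by
      intro a b ha hb
      field_simp
      ring
    rw [hA, hD, this _ _ hY' hY]
    rw [lam, lam, if_neg (by linarith), if_neg (by linarith)] at hlam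
    rw [hlam, sub_self, mul_zero]
  · simp only [hu₁, abs_one, Real.one_rpow]
    field_simp
    ring
  · simp only [hur, phi_neg]
    have : A * (1 + phi p r) = 1 + phi p R := by rw [hA]; field_simp
    linarith
  · simp only [hu₁, phi_one]; ring

theorem exists_majorant_of_lam_eq (hp : 2 < p) {R r : ℝ} (hR : -1 < R) (hRr : R < r)
    (hr₀ : 0 < r) (hr₁ : r ≤ 1) (hlam : lam p r = lam p R) :
    ∃ c₀ c₁ c₂ c₃ c₄ : ℝ,
      (∀ x y : ℝ, x * y ≤ c₀ + c₁ * x + c₂ * y + c₃ * |x| ^ p + c₄ * |y| ^ (p / (p - 1))) ∧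
      c₀ + c₁ + c₂ + c₃ + c₄ = 1 ∧
      c₀ - c₁ * r - c₂ * phi p R + c₃ * |r| ^ p + c₄ * |R| ^ p = r * phi p R := by
  have hX : 0 < 1 + R := by linarith
  have hX' : 0 < 1 + r := by linarith
  have hY : 0 < 1 + phi p R := by linarith [neg_one_lt_phi hp hR]
  have hY' : 0 < 1 + phi p r := by linarith [neg_one_lt_phi hp (hR.trans hRr)]
  have hp₁ : 0 < p - 1 := by linarith
  obtain ⟨A, hA⟩ : ∃ A, A = (1 + phi p R) / (1 + phi p r) := ⟨_, rfl⟩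
  obtain ⟨D, hD⟩ : ∃ D, D = (1 + r) / (1 + R) := ⟨_, rfl⟩
  have hD₀ : 0 < D := by rw [hD]; positivity
  refine ⟨-1 + A * (1 - 1 / p) + D / p, 1 - A, 1 - D, A / p, D * (1 - 1 / p), ?_, ?_, ?_⟩
  · intro x y
    have h := reduced_gap_nonneg hp hR hRr hr₀ hr₁ hlam hA hD x
    have hy := mul_le_mul_of_nonneg_left (Real.young_inequality ((x + D - 1) / D) y
      (Real.HolderConjugate.conjExponent (by linarith : 1 < p))) hD₀.le
    rw [Real.conjExponent] at hy
    have e₁ : D * ((x + D - 1) / D * y) = (x + D - 1) * y := by field_simp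
    have e₂ : |y| ^ (p / (p - 1)) / (p / (p - 1)) = (1 - 1 / p) * |y| ^ (p / (p - 1)) := by
      field_simp
    rw [e₁, mul_add, e₂] at hy
    linear_combination h + hy
  · field_simp; ring
  · rw [← mul_phi hp, ← mul_phi hp]
    have : ∀ a b : ℝ, 0 < 1 + a → 0 < 1 + b →
        -1 + (1 + b) / (1 + a) * (1 - 1 / p) + (1 + r) / (1 + R) / p
          - (1 - (1 + b) / (1 + a)) * r - (1 - (1 + r) / (1 + R)) * b
          + (1 + b) / (1 + a) / p * (r * a) + (1 + r) / (1 + R) * (1 - 1 / p) * (R * b)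
        = r * b + (1 + r) * (1 + b) / p
          * (1 / (1 + R) - (p - 1) / (1 + b) - (1 / (1 + r) - (p - 1) / (1 + a))) := by
      intro a b ha hb
      field_simp
      ring
    rw [hA, hD, this _ _ hY' hY]
    rw [lam, lam, if_neg (by linarith), if_neg (by linarith)] at hlam
    rw [hlam, sub_self, mul_zero, add_zero]

theorem exists_majorant_self (hp : 2 < p) (r : ℝ) :
    ∃ c₀ c₁ c₂ c₃ c₄ : ℝ,
      (∀ x y : ℝ, x * y ≤ c₀ + c₁ * x + c₂ * y + c₃ * |x| ^ p + c₄ * |y| ^ (p / (p - 1))) ∧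
      c₀ + c₁ + c₂ + c₃ + c₄ = 1 ∧
      c₀ - c₁ * r - c₂ * phi p r + c₃ * |r| ^ p + c₄ * |r| ^ p = r * phi p r := by
  have hp₁ : 0 < p - 1 := by linarith
  refine ⟨0, 0, 0, 1 / p, 1 - 1 / p, ?_, by ring, ?_⟩
  · intro x y
    have hy := Real.young_inequality x y
      (Real.HolderConjugate.conjExponent (by linarith : 1 < p))
    rw [Real.conjExponent] at hy
    have e₂ : |y| ^ (p / (p - 1)) / (p / (p - 1)) = (1 - 1 / p) * |y| ^ (p / (p - 1)) := by
      field_simp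
    rw [e₂] at hy
    linear_combination hy
  · rw [mul_phi hp]; ring

end Majorant

section Bellman

instance isProbabilityMeasure_mu : IsProbabilityMeasure mu :=
  ⟨by simp [mu]⟩

theorem mu_real_Iic {τ : ℝ} (hτ : τ ∈ Set.Icc (0 : ℝ) 1) : mu.real (Set.Iic τ) = τ := by
  have h : Set.Iic τ ∩ Set.Icc (0 : ℝ) 1 = Set.Icc 0 τ := by
    ext x
    simp only [Set.mem_inter_iff, Set.mem_Iic, Set.mem_Icc]
    exact ⟨fun h => ⟨h.2.1, h.1⟩, fun h => ⟨h.2, h.1, h.2.trans hτ.2⟩⟩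
  rw [mu, measureReal_restrict_apply measurableSet_Iic, h]
  simp [hτ.1]

theorem integrable_step (τ α β : ℝ) : Integrable (fun t : ℝ => if t ≤ τ then α else β) mu :=
  Integrable.of_bound (C := max |α| |β|)
    (Measurable.ite measurableSet_Iic measurable_const measurable_const).aestronglyMeasurable
    (Filter.Eventually.of_forall fun t => by
      simp only [Real.norm_eq_abs]
      split_ifs
      · exact le_max_left _ _
      · exact le_max_right _ _)

theorem integral_step {τ : ℝ} (hτ : τ ∈ Set.Icc (0 : ℝ) 1) (α β : ℝ) :
    ∫ t, (if t ≤ τ then α else β) ∂mu = τ * α + (1 - τ) * β := by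
  have h : (fun t : ℝ => if t ≤ τ then α else β)
      = fun t => β + (Set.Iic τ).indicator (fun _ => α - β) t := by
    funext t
    by_cases ht : t ≤ τ <;> simp [ht]
  rw [h, integral_add (integrable_const _)
    ((integrable_const _).indicator measurableSet_Iic), integral_const,
    integral_indicator_const _ measurableSet_Iic, mu_real_Iic hτ]
  simp only [probReal_univ, smul_eq_mul]
  ring

/-- If the value along a segment is an upper bound, it is attained by a two-valued pair. -/
theorem Bc_eq_of_upperBound {θ a₁ a₂ b₁ b₂ τ v : ℝ} (hτ : τ ∈ Set.Icc (0 : ℝ) 1)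
    (hv : v = τ * (a₁ * a₂) + (1 - τ) * (b₁ * b₂))
    (hub : ∀ f g : ℝ → ℝ, Integrable f mu → Integrable g mu →
      Integrable (fun t => f t * g t) mu → Integrable (fun t => |f t| ^ θ) mu →
      Integrable (fun t => |g t| ^ (θ / (θ - 1))) mu →
      (∫ t, f t ∂mu) = τ * a₁ + (1 - τ) * b₁ → (∫ t, g t ∂mu) = τ * a₂ + (1 - τ) * b₂ →
      (∫ t, |f t| ^ θ ∂mu) = τ * |a₁| ^ θ + (1 - τ) * |b₁| ^ θ →
      (∫ t, |g t| ^ (θ / (θ - 1)) ∂mu)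
        = τ * |a₂| ^ (θ / (θ - 1)) + (1 - τ) * |b₂| ^ (θ / (θ - 1)) →
      ∫ t, f t * g t ∂mu ≤ v) :
    Bc θ (τ * a₁ + (1 - τ) * b₁) (τ * a₂ + (1 - τ) * b₂)
      (τ * |a₁| ^ θ + (1 - τ) * |b₁| ^ θ)
      (τ * |a₂| ^ (θ / (θ - 1)) + (1 - τ) * |b₂| ^ (θ / (θ - 1))) = v := by
  refine IsGreatest.csSup_eq ⟨?_, ?_⟩
  · have hpow : ∀ s α β : ℝ, (fun t : ℝ => |if t ≤ τ then α else β| ^ s)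
        = fun t => if t ≤ τ then |α| ^ s else |β| ^ s := by
      intro s α β
      funext t
      split_ifs <;> rfl
    have hmul : (fun t : ℝ => (if t ≤ τ then a₁ else b₁) * (if t ≤ τ then a₂ else b₂))
        = fun t => if t ≤ τ then a₁ * a₂ else b₁ * b₂ := by
      funext t
      split_ifs <;> rfl
    refine ⟨fun t => if t ≤ τ then a₁ else b₁, fun t => if t ≤ τ then a₂ else b₂,
      integrable_step _ _ _, integrable_step _ _ _, ?_, ?_, ?_, integral_step hτ _ _,
      integral_step hτ _ _, ?_, ?_, ?_⟩
    · rw [hmul]; exact integrable_step _ _ _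
    · rw [hpow]; exact integrable_step _ _ _
    · rw [hpow]; exact integrable_step _ _ _
    · rw [hpow]; exact integral_step hτ _ _
    · rw [hpow]; exact integral_step hτ _ _
    · rw [hmul, integral_step hτ, hv]
  · rintro y ⟨f, g, h₁, h₂, h₃, h₄, h₅, h₆, h₇, h₈, h₉, rfl⟩
    exact hub f g h₁ h₂ h₃ h₄ h₅ h₆ h₇ h₈ h₉

theorem integral_mul_le_of_majorant {s s' c₀ c₁ c₂ c₃ c₄ a₁ a₂ : ℝ} {f g : ℝ → ℝ}
    (ha : 0 < a₁ * a₂)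
    (hmaj : ∀ x y : ℝ, x * y ≤ c₀ + c₁ * x + c₂ * y + c₃ * |x| ^ s + c₄ * |y| ^ s')
    (hf : Integrable f mu) (hg : Integrable g mu) (hfg : Integrable (fun t => f t * g t) mu)
    (hfs : Integrable (fun t => |f t| ^ s) mu) (hgs : Integrable (fun t => |g t| ^ s') mu) :
    ∫ t, f t * g t ∂mu ≤ a₁ * a₂ * (c₀ + c₁ / a₁ * (∫ t, f t ∂mu) + c₂ / a₂ * (∫ t, g t ∂mu)
      + c₃ / |a₁| ^ s * (∫ t, |f t| ^ s ∂mu) + c₄ / |a₂| ^ s' * (∫ t, |g t| ^ s' ∂mu)) := by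
  have h₁ : a₁ ≠ 0 := left_ne_zero_of_mul ha.ne'
  have h₂ : a₂ ≠ 0 := right_ne_zero_of_mul ha.ne'
  have i₀ : Integrable (fun _ : ℝ => c₀) mu := integrable_const _
  have i₁ := hf.const_mul (c₁ / a₁)
  have i₂ := hg.const_mul (c₂ / a₂)
  have i₃ := hfs.const_mul (c₃ / |a₁| ^ s)
  have i₄ := hgs.const_mul (c₄ / |a₂| ^ s')
  have j₁ : Integrable (fun t => c₀ + c₁ / a₁ * f t) mu := i₀.add i₁
  have j₂ : Integrable (fun t => c₀ + c₁ / a₁ * f t + c₂ / a₂ * g t) mu := j₁.add i₂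
  have j₃ : Integrable (fun t => c₀ + c₁ / a₁ * f t + c₂ / a₂ * g t
      + c₃ / |a₁| ^ s * |f t| ^ s) mu := j₂.add i₃
  have hle : ∫ t, f t * g t ∂mu ≤ ∫ t, a₁ * a₂ * (c₀ + c₁ / a₁ * f t + c₂ / a₂ * g t
      + c₃ / |a₁| ^ s * |f t| ^ s + c₄ / |a₂| ^ s' * |g t| ^ s') ∂mu := by
    refine integral_mono hfg ((j₃.add i₄).const_mul _) fun t => ?_
    have h := mul_le_mul_of_nonneg_left (hmaj (f t / a₁) (g t / a₂)) ha.le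
    rw [abs_div, abs_div, Real.div_rpow (abs_nonneg _) (abs_nonneg _),
      Real.div_rpow (abs_nonneg _) (abs_nonneg _)] at h
    have e : a₁ * a₂ * (f t / a₁ * (g t / a₂)) = f t * g t := by field_simp
    rw [e] at h
    refine h.trans (le_of_eq ?_)
    ring
  refine hle.trans (le_of_eq ?_)
  rw [integral_const_mul, integral_add j₃ i₄,
    integral_add j₂ i₃, integral_add j₁ i₂, integral_add i₀ i₁,
    integral_const_mul, integral_const_mul, integral_const_mul, integral_const_mul,
    integral_const]
  simp

theorem one_add_mul_sub_one_lt_abs_rpow {s x : ℝ} (hs : 1 < s) (hx : x ≠ 1) :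
    1 + s * (x - 1) < |x| ^ s := by
  rcases eq_or_ne |x| 1 with h | h
  · have : x = -1 := (eq_or_eq_neg_of_abs_eq h).resolve_left hx
    rw [h, Real.one_rpow, this]
    linarith
  · have h₁ := one_add_mul_self_lt_rpow_one_add (s := |x| - 1)
      (by linarith [abs_nonneg x]) (sub_ne_zero.2 h) hs
    rw [add_sub_cancel] at h₁
    nlinarith [le_abs_self x]

/-- Equality in Jensen's inequality for `|·| ^ s`, `1 < s`, forces a function to be constant. -/
theorem ae_eq_const_of_integral_abs_rpow {s c : ℝ} {g : ℝ → ℝ} (hs : 1 < s) (hc : c ≠ 0)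
    (hg : Integrable g mu) (hgs : Integrable (fun t => |g t| ^ s) mu)
    (h₁ : ∫ t, g t ∂mu = c) (h₂ : ∫ t, |g t| ^ s ∂mu = |c| ^ s) :
    ∀ᵐ t ∂mu, g t = c := by
  have hcs : |c| ^ s ≠ 0 := (Real.rpow_pos_of_pos (abs_pos.2 hc) s).ne'
  have i₀ : Integrable (fun _ : ℝ => 1 - s) mu := integrable_const _
  have i₁ := hg.const_mul (s / c)
  have i₂ := hgs.const_mul (1 / |c| ^ s)
  have i₃ : Integrable (fun t => 1 - s + s / c * g t) mu := i₀.add i₁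
  have hpow : ∀ t, 1 / |c| ^ s * |g t| ^ s = |g t / c| ^ s := by
    intro t
    rw [abs_div, Real.div_rpow (abs_nonneg _) (abs_nonneg _)]
    ring
  have hlt : ∀ t, g t ≠ c → 0 < 1 / |c| ^ s * |g t| ^ s - (1 - s + s / c * g t) := by
    intro t ht
    have h := one_add_mul_sub_one_lt_abs_rpow hs (x := g t / c)
      (fun h => ht ((div_eq_one_iff_eq hc).1 h))
    rw [hpow]
    linear_combination h
  have hnonneg : 0 ≤ fun t => 1 / |c| ^ s * |g t| ^ s - (1 - s + s / c * g t) := by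
    intro t
    by_cases ht : g t = c
    · simp only [Pi.zero_apply, ht]
      rw [div_mul_cancel₀ s hc, one_div_mul_cancel hcs]
      linarith
    · exact (hlt t ht).le
  have hzero : ∫ t, 1 / |c| ^ s * |g t| ^ s - (1 - s + s / c * g t) ∂mu = 0 := by
    rw [integral_sub i₂ i₃, integral_add i₀ i₁, integral_const_mul,
      integral_const_mul, integral_const, h₁, h₂]
    simp only [probReal_univ, smul_eq_mul]
    field_simp
    ring
  have h := (integral_eq_zero_iff_of_nonneg hnonneg (i₂.sub i₃)).1 hzero
  filter_upwards [h] with t ht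
  by_contra hne
  exact (hlt t hne).ne' ht

end Bellman

theorem Bc_linear_on_segments (p q : ℝ) (hp : 2 < p) (hq : q = p / (p - 1))
    (R₀ : ℝ) (hR₀mem : R₀ ∈ Set.Ioo (0 : ℝ) 1)
    (hR₀eq : R₀ ^ ((p - 1) / 2) + R₀ ^ (-((p - 1) / 2))
      = (p - 1) * (R₀ ^ ((1 : ℝ) / 2) + R₀ ^ (-(1 : ℝ) / 2)))
    (ρ : ℝ → ℝ)
    (hρ₁ : ∀ R ∈ Set.Icc R₀ (1 : ℝ), ρ R = R)
    (hρ₂ : ∀ R ∈ Set.Icc (-1 : ℝ) R₀, ρ R ∈ Set.Icc R₀ 1 ∧ lam p (ρ R) = lam p R) :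
    ∀ R ∈ Set.Icc (-1 : ℝ) 1, ∀ a₁ a₂ : ℝ, 0 < a₁ * a₂ → ∀ τ ∈ Set.Icc (0 : ℝ) 1,
      (Bc p (τ * a₁ + (1 - τ) * (-(ρ R) * a₁))
            (τ * a₂ + (1 - τ) * (-(phi p R) * a₂))
            (τ * |a₁| ^ p + (1 - τ) * |ρ R * a₁| ^ p)
            (τ * |a₂| ^ q + (1 - τ) * (|R| ^ p * |a₂| ^ q))
          = a₁ * a₂ * (τ + (1 - τ) * (ρ R * phi p R))) ∧
      (R ∈ Set.Icc R₀ 1 →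
        Bc p (τ * a₁ + (1 - τ) * (-(ρ R) * a₁))
            (τ * a₂ + (1 - τ) * (-(phi p R) * a₂))
            (τ * |a₁| ^ p + (1 - τ) * |ρ R * a₁| ^ p)
            (τ * |a₂| ^ q + (1 - τ) * (|R| ^ p * |a₂| ^ q))
          = (τ * |a₁| ^ p + (1 - τ) * |ρ R * a₁| ^ p) ^ ((1 : ℝ) / p)
              * (τ * |a₂| ^ q + (1 - τ) * (|R| ^ p * |a₂| ^ q)) ^ ((1 : ℝ) / q)) := by
  subst hq
  intro R hR a₁ a₂ ha τ hτ
  have hp₁ : 0 < p - 1 := by linarith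
  have ha₁ : a₁ ≠ 0 := left_ne_zero_of_mul ha.ne'
  have ha₂ : a₂ ≠ 0 := right_ne_zero_of_mul ha.ne'
  have hP₁ : |a₁| ^ p ≠ 0 := (Real.rpow_pos_of_pos (abs_pos.2 ha₁) _).ne'
  have hP₂ : |a₂| ^ (p / (p - 1)) ≠ 0 := (Real.rpow_pos_of_pos (abs_pos.2 ha₂) _).ne'
  have e₁ : |ρ R * a₁| ^ p = |-(ρ R) * a₁| ^ p := by rw [neg_mul, abs_neg]
  have e₁' : |-(ρ R) * a₁| ^ p = |ρ R| ^ p * |a₁| ^ p := by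
    rw [abs_mul, abs_neg, Real.mul_rpow (abs_nonneg _) (abs_nonneg _)]
  have e₂ : |R| ^ p * |a₂| ^ (p / (p - 1)) = |-(phi p R) * a₂| ^ (p / (p - 1)) := by
    rw [abs_mul, abs_neg, Real.mul_rpow (abs_nonneg _) (abs_nonneg _), abs_phi_rpow hp]
  have hmain : Bc p (τ * a₁ + (1 - τ) * (-(ρ R) * a₁))
      (τ * a₂ + (1 - τ) * (-(phi p R) * a₂))
      (τ * |a₁| ^ p + (1 - τ) * |ρ R * a₁| ^ p)
      (τ * |a₂| ^ (p / (p - 1)) + (1 - τ) * (|R| ^ p * |a₂| ^ (p / (p - 1))))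
      = a₁ * a₂ * (τ + (1 - τ) * (ρ R * phi p R)) := by
    rw [e₁, e₂]
    refine Bc_eq_of_upperBound hτ (by ring) fun f g hf hg hfg hfs hgs h₁ h₂ h₃ h₄ => ?_
    rcases eq_or_lt_of_le hR.1 with rfl | hR₁
    · have hphi : phi p (-1) = -1 := by rw [phi_neg, phi_one]
      rw [hphi] at h₂ h₄
      have hae := ae_eq_const_of_integral_abs_rpow
        (by rw [one_lt_div hp₁]; linarith) ha₂ hg hgs
        (by rw [h₂]; ring) (by rw [h₄, neg_neg, one_mul]; ring)
      have hint : ∫ t, f t * g t ∂mu = ∫ t, f t * a₂ ∂mu := by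
        refine integral_congr_ae ?_
        filter_upwards [hae] with t ht
        rw [ht]
      rw [hint, integral_mul_const, h₁, hphi]
      exact le_of_eq (by ring)
    · obtain ⟨c₀, c₁, c₂, c₃, c₄, hmaj, hone, hend⟩ : ∃ c₀ c₁ c₂ c₃ c₄ : ℝ,
          (∀ x y : ℝ, x * y ≤
            c₀ + c₁ * x + c₂ * y + c₃ * |x| ^ p + c₄ * |y| ^ (p / (p - 1))) ∧
          c₀ + c₁ + c₂ + c₃ + c₄ = 1 ∧
          c₀ - c₁ * ρ R - c₂ * phi p R + c₃ * |ρ R| ^ p + c₄ * |R| ^ p = ρ R * phi p R := by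
        rcases lt_or_ge R R₀ with hlt | hge
        · obtain ⟨hmem, hlam⟩ := hρ₂ R ⟨hR.1, hlt.le⟩
          exact exists_majorant_of_lam_eq hp hR₁ (hlt.trans_le hmem.1)
            (hR₀mem.1.trans_le hmem.1) hmem.2 hlam
        · rw [hρ₁ R ⟨hge, hR.2⟩]
          exact exists_majorant_self hp R
      refine (integral_mul_le_of_majorant ha hmaj hf hg hfg hfs hgs).trans (le_of_eq ?_)
      rw [h₁, h₂, h₃, h₄, e₁', ← e₂]
      congr 1
      field_simp
      linear_combination τ * hone + (1 - τ) * hend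
  refine ⟨hmain, fun hRm => ?_⟩
  rw [hmain, e₁, e₁', hρ₁ R hRm, mul_phi hp]
  have hS : 0 ≤ τ + (1 - τ) * |R| ^ p :=
    add_nonneg hτ.1 (mul_nonneg (sub_nonneg.2 hτ.2) (Real.rpow_nonneg (abs_nonneg _) _))
  have f₁ : τ * |a₁| ^ p + (1 - τ) * (|R| ^ p * |a₁| ^ p)
      = (τ + (1 - τ) * |R| ^ p) * |a₁| ^ p := by ring
  have f₂ : τ * |a₂| ^ (p / (p - 1)) + (1 - τ) * (|R| ^ p * |a₂| ^ (p / (p - 1)))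
      = (τ + (1 - τ) * |R| ^ p) * |a₂| ^ (p / (p - 1)) := by ring
  have hp₀ : p ≠ 0 := by linarith
  have hq₀ : p / (p - 1) ≠ 0 := div_ne_zero hp₀ hp₁.ne'
  have hsum : 1 / p + 1 / (p / (p - 1)) = 1 := by field_simp; ring
  rw [f₁, f₂, Real.mul_rpow hS (Real.rpow_nonneg (abs_nonneg _) _),
    Real.mul_rpow hS (Real.rpow_nonneg (abs_nonneg _) _),
    ← Real.rpow_mul (abs_nonneg _), ← Real.rpow_mul (abs_nonneg _),
    mul_one_div_cancel hp₀, mul_one_div_cancel hq₀, Real.rpow_one, Real.rpow_one,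
    mul_mul_mul_comm, ← Real.rpow_add' hS (by rw [hsum]; exact one_ne_zero), hsum,
    Real.rpow_one, ← abs_mul, abs_of_pos ha]
  ring
end

section
/- Fix p ≥ 2 and q = p/(p−1), and let t₀, t₁, t₂, t₃, t₄ ∈ ℝ. Define Φ(x₁,x₂) = t₀ + t₁x₁ + t₂x₂ + t₃|x₁|^p + t₄|x₂|^q − x₁x₂ for (x₁,x₂) ∈ ℝ², and, when t₄ > 0, define H(x₁) = t₀ − (1/p)·|x₁ − t₂|^p / (q t₄)^{p−1} + t₃|x₁|^p + t₁x₁. Then Φ(x₁,x₂) ≥ 0 for all (x₁,x₂) ∈ ℝ² if and only if t₃ > 0, t₄ > 0, and H(x₁) ≥ 0 for all x₁ ∈ ℝ. -/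
/-- Weighted Young inequality for conjugate exponents. -/
theorem Real.HolderConjugate.mul_le_weighted {p q : ℝ} (h : p.HolderConjugate q) {t : ℝ}
    (ht : 0 < t) (y x : ℝ) :
    y * x ≤ (1 / p) * |y| ^ p / (q * t) ^ (p - 1) + t * |x| ^ q := by
  have hA : 0 < q * t := mul_pos h.symm.pos ht
  have hs : 0 < (q * t) ^ (1 / q) := Real.rpow_pos_of_pos hA _
  have young := Real.young_inequality (y / (q * t) ^ (1 / q)) ((q * t) ^ (1 / q) * x) h
  have hsp : ((q * t) ^ (1 / q)) ^ p = (q * t) ^ (p - 1) := by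
    rw [← Real.rpow_mul hA.le, ← h.div_conj_eq_sub_one]
    congr 1
    ring
  have hsq : ((q * t) ^ (1 / q)) ^ q = q * t := by
    rw [← Real.rpow_mul hA.le, one_div_mul_cancel h.symm.ne_zero, Real.rpow_one]
  rw [abs_div, abs_mul, abs_of_pos hs, Real.div_rpow (abs_nonneg _) hs.le,
    Real.mul_rpow hs.le (abs_nonneg _), hsp, hsq] at young
  have hq0 := h.symm.ne_zero
  calc y * x = y / (q * t) ^ (1 / q) * ((q * t) ^ (1 / q) * x) := by field_simp
    _ ≤ _ := young
    _ = _ := by field_simp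

/-- Equality is attained in the weighted Young inequality. -/
theorem Real.HolderConjugate.exists_mul_eq_weighted {p q : ℝ} (h : p.HolderConjugate q) {t : ℝ}
    (ht : 0 < t) (y : ℝ) :
    ∃ x : ℝ, y * x = (1 / p) * |y| ^ p / (q * t) ^ (p - 1) + t * |x| ^ q := by
  have hA : 0 < q * t := mul_pos h.symm.pos ht
  have attained_of_nonneg : ∀ u : ℝ, 0 ≤ u → ∃ x : ℝ,
      u * x = (1 / p) * |u| ^ p / (q * t) ^ (p - 1) + t * |x| ^ q := by
    intro u hu
    have hb : 0 ≤ u / (q * t) := div_nonneg hu hA.le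
    refine ⟨(u / (q * t)) ^ (p - 1), ?_⟩
    have hpow : ((u / (q * t)) ^ (p - 1)) ^ q = (u / (q * t)) ^ (p - 1) * (u / (q * t)) := by
      rw [← Real.rpow_mul hb, h.sub_one_mul_conj]
      conv_rhs => rw [← Real.rpow_add_one' hb (by simpa using h.ne_zero), sub_add_cancel]
    have hup : u ^ p = u ^ (p - 1) * u := by
      rw [← Real.rpow_add_one' hu (by simpa using h.ne_zero), sub_add_cancel]
    rw [abs_of_nonneg hu, abs_of_nonneg (Real.rpow_nonneg hb _), hpow, hup,
      Real.div_rpow hu hA.le]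
    have hApow : (q * t) ^ (p - 1) ≠ 0 := (Real.rpow_pos_of_pos hA _).ne'
    have hinv : 1 / p + 1 / q = 1 := by simpa using h.inv_add_inv_eq_one
    have hq0 := h.symm.ne_zero
    have hsplit : t * (u ^ (p - 1) / (q * t) ^ (p - 1) * (u / (q * t)))
        = (1 / q) * (u ^ (p - 1) * u) / (q * t) ^ (p - 1) := by
      field_simp
    rw [hsplit]
    linear_combination (-(u ^ (p - 1) * u / (q * t) ^ (p - 1))) * hinv
  rcases le_total 0 y with hy | hy
  · exact attained_of_nonneg y hy
  · obtain ⟨x, hx⟩ := attained_of_nonneg (-y) (neg_nonneg.mpr hy)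
    refine ⟨-x, ?_⟩
    rw [abs_neg] at hx ⊢
    linarith

theorem Phi_nonneg_iff (p q : ℝ) (hp : 2 ≤ p) (hq : q = p / (p - 1))
    (t₀ t₁ t₂ t₃ t₄ : ℝ) :
    (∀ x₁ x₂ : ℝ,
        0 ≤ t₀ + t₁ * x₁ + t₂ * x₂ + t₃ * |x₁| ^ p + t₄ * |x₂| ^ q - x₁ * x₂)
      ↔ (0 < t₃ ∧ 0 < t₄ ∧ ∀ x₁ : ℝ,
          0 ≤ t₀ - (1 / p) * |x₁ - t₂| ^ p / (q * t₄) ^ (p - 1)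
              + t₃ * |x₁| ^ p + t₁ * x₁) := by
  have hpq : p.HolderConjugate q :=
    (Real.holderConjugate_iff_eq_conjExponent (by linarith)).mpr hq
  constructor
  · intro hΦ
    have ht₃ : 0 < t₃ := by
      by_contra! hle
      let c := t₀ + t₂ * (t₁ + 1) + t₄ * |t₁ + 1| ^ q
      have hc : c = t₀ + t₂ * (t₁ + 1) + t₄ * |t₁ + 1| ^ q := rfl
      have hneg := mul_nonpos_of_nonpos_of_nonneg hle
        (Real.rpow_nonneg (abs_nonneg (c + 1)) p)
      linarith [hΦ (c + 1) (t₁ + 1)]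
    have ht₄ : 0 < t₄ := by
      by_contra! hle
      let c := t₀ + t₁ * (t₂ + 1) + t₃ * |t₂ + 1| ^ p
      have hc : c = t₀ + t₁ * (t₂ + 1) + t₃ * |t₂ + 1| ^ p := rfl
      have hneg := mul_nonpos_of_nonpos_of_nonneg hle
        (Real.rpow_nonneg (abs_nonneg (c + 1)) q)
      linarith [hΦ (t₂ + 1) (c + 1)]
    refine ⟨ht₃, ht₄, fun x₁ => ?_⟩
    obtain ⟨x₂, hx₂⟩ := hpq.exists_mul_eq_weighted ht₄ (x₁ - t₂)
    linarith [hΦ x₁ x₂]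
  · rintro ⟨-, ht₄, hH⟩ x₁ x₂
    linarith [hH x₁, hpq.mul_le_weighted ht₄ (x₁ - t₂) x₂]
end

section
/- Fix p ≥ 2 and q = p/(p−1). For every (x₁,x₂,x₃,x₄) ∈ ℝ⁴ with x₃ ≥ |x₁|^p and x₄ ≥ |x₂|^q, the Bellman function satisfies B_{c,+}(x₁,x₂,x₃,x₄) ≥ x₁x₂ + √( (x₃^{2/p} − x₁²)·(x₄^{2/q} − x₂²) ). -/
open MeasureTheory

/-- The function equal to `a` on `(-∞, s]` and to `b` on `(s, ∞)`. -/
noncomputable def step (s a b : ℝ) : ℝ → ℝ := fun t => if t ≤ s then a else b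

lemma comp_step (h : ℝ → ℝ) (s a b : ℝ) :
    (fun t => h (step s a b t)) = step s (h a) (h b) := by
  funext t; unfold step; split_ifs <;> rfl

lemma step_mul_step (s a b c d : ℝ) :
    (fun t => step s a b t * step s c d t) = step s (a * c) (b * d) := by
  funext t; unfold step; split_ifs <;> rfl

instance isFiniteMeasure_mu : IsFiniteMeasure mu := by unfold mu; infer_instance

lemma step_eq_indicator (s a b : ℝ) :
    step s a b = fun t => (Set.Iic s).indicator (fun _ => a - b) t + b := by
  funext t
  by_cases h : t ≤ s <;> simp [step, h]

lemma integrable_step_s15 (s a b : ℝ) : Integrable (step s a b) mu := by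
  rw [step_eq_indicator]
  exact ((integrable_const _).indicator measurableSet_Iic).add (integrable_const _)

lemma integral_step_s15 {s : ℝ} (hs0 : 0 ≤ s) (hs1 : s ≤ 1) (a b : ℝ) :
    ∫ t, step s a b t ∂mu = s * a + (1 - s) * b := by
  rw [step_eq_indicator, integral_add ((integrable_const _).indicator measurableSet_Iic)
    (integrable_const _), integral_indicator measurableSet_Iic, setIntegral_const, integral_const]
  have h1 : mu.real (Set.Iic s) = s := by
    have : Set.Iic s ∩ Set.Icc (0 : ℝ) 1 = Set.Icc 0 s := by
      ext t; simp only [Set.mem_inter_iff, Set.mem_Iic, Set.mem_Icc]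
      constructor
      · rintro ⟨h, h', -⟩; exact ⟨h', h⟩
      · rintro ⟨h, h'⟩; exact ⟨h', h, h'.trans hs1⟩
    simp [mu, measureReal_restrict_apply measurableSet_Iic, this, hs0]
  have h2 : mu.real Set.univ = 1 := by simp [mu]
  rw [h1, h2]
  simp only [smul_eq_mul]
  ring

lemma integral_mul_le_Bc {p q : ℝ} (hpq : p.HolderConjugate q) {x₁ x₂ x₃ x₄ : ℝ} {f g : ℝ → ℝ}
    (hf : Integrable f mu) (hg : Integrable g mu) (hfg : Integrable (fun t => f t * g t) mu)
    (hfp : Integrable (fun t => |f t| ^ p) mu) (hgq : Integrable (fun t => |g t| ^ q) mu)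
    (h₁ : ∫ t, f t ∂mu = x₁) (h₂ : ∫ t, g t ∂mu = x₂)
    (h₃ : ∫ t, |f t| ^ p ∂mu = x₃) (h₄ : ∫ t, |g t| ^ q ∂mu = x₄) :
    ∫ t, f t * g t ∂mu ≤ Bc p x₁ x₂ x₃ x₄ := by
  obtain rfl : q = p / (p - 1) := hpq.conjugate_eq
  refine le_csSup ⟨x₃ / p + x₄ / (p / (p - 1)), ?_⟩
    ⟨f, g, hf, hg, hfg, hfp, hgq, h₁, h₂, h₃, h₄, rfl⟩
  rintro y ⟨f, g, -, -, hfg, hfp, hgq, -, -, rfl, rfl, rfl⟩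
  rw [← integral_div, ← integral_div, ← integral_add (hfp.div_const _) (hgq.div_const _)]
  exact integral_mono hfg ((hfp.div_const _).add (hgq.div_const _))
    fun t => Real.young_inequality (f t) (g t) hpq

lemma two_point_le_Bc {p q : ℝ} (hpq : p.HolderConjugate q) {s a b c d x₁ x₂ x₃ x₄ : ℝ}
    (hs0 : 0 ≤ s) (hs1 : s ≤ 1)
    (h₁ : s * a + (1 - s) * b = x₁) (h₂ : s * c + (1 - s) * d = x₂)
    (h₃ : s * |a| ^ p + (1 - s) * |b| ^ p = x₃) (h₄ : s * |c| ^ q + (1 - s) * |d| ^ q = x₄) :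
    s * (a * c) + (1 - s) * (b * d) ≤ Bc p x₁ x₂ x₃ x₄ := by
  have hp := comp_step (fun u => |u| ^ p) s a b
  have hq := comp_step (fun u => |u| ^ q) s c d
  have hm := step_mul_step s a b c d
  have key := integral_mul_le_Bc hpq (x₁ := x₁) (x₂ := x₂) (x₃ := x₃) (x₄ := x₄)
    (integrable_step_s15 s a b) (integrable_step_s15 s c d)
    (by rw [hm]; exact integrable_step_s15 _ _ _) (by rw [hp]; exact integrable_step_s15 _ _ _)
    (by rw [hq]; exact integrable_step_s15 _ _ _)
    (by rw [integral_step_s15 hs0 hs1, h₁]) (by rw [integral_step_s15 hs0 hs1, h₂])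
    (by rw [hp, integral_step_s15 hs0 hs1, h₃]) (by rw [hq, integral_step_s15 hs0 hs1, h₄])
  rwa [hm, integral_step_s15 hs0 hs1] at key

lemma exists_two_point {q : ℝ} (hq : 0 < q) {s x y : ℝ} (hs0 : 0 < s) (hs1 : s < 1)
    (hxy : |x| ^ q ≤ y) :
    ∃ C : ℝ, 0 ≤ C ∧ s * |x + (1 - s) * C| ^ q + (1 - s) * |x - s * C| ^ q = y := by
  have hs1' : 0 < 1 - s := sub_pos.2 hs1
  have hy : 0 ≤ y := (by positivity : 0 ≤ |x| ^ q).trans hxy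
  set N : ℝ := (|x| + (y / s) ^ q⁻¹) / (1 - s) with hN
  have hN0 : 0 ≤ N := by positivity
  have hcont : Continuous fun C : ℝ =>
      s * |x + (1 - s) * C| ^ q + (1 - s) * |x - s * C| ^ q := by
    refine Continuous.add (continuous_const.mul (Continuous.rpow_const (by fun_prop) ?_))
      (continuous_const.mul (Continuous.rpow_const (by fun_prop) ?_)) <;>
    exact fun _ => Or.inr hq.le
  have hlarge : (y / s) ^ q⁻¹ ≤ |x + (1 - s) * N| := by
    have h : (1 - s) * N = |x| + (y / s) ^ q⁻¹ := by rw [hN]; field_simp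
    rw [h]
    refine le_trans ?_ (le_abs_self _)
    linarith [neg_abs_le x]
  have hend : y ≤ s * |x + (1 - s) * N| ^ q + (1 - s) * |x - s * N| ^ q := by
    have h := Real.rpow_le_rpow (by positivity) hlarge hq.le
    rw [Real.rpow_inv_rpow (by positivity) hq.ne', div_le_iff₀' hs0] at h
    have : 0 ≤ (1 - s) * |x - s * N| ^ q := by positivity
    linarith
  obtain ⟨C, hC, hCy⟩ := intermediate_value_Icc hN0 hcont.continuousOn
    (show y ∈ Set.Icc _ _ from ⟨by simp only [mul_zero, add_zero, sub_zero]; linarith, hend⟩)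
  exact ⟨C, hC.1, hCy⟩

lemma rpow_two_div_le_two_point {q : ℝ} (hq : 0 < q) (hq2 : q ≤ 2) {s c d y : ℝ}
    (hs0 : 0 ≤ s) (hs1 : s ≤ 1) (hy : s * |c| ^ q + (1 - s) * |d| ^ q = y) :
    y ^ (2 / q) ≤ s * c ^ 2 + (1 - s) * d ^ 2 := by
  have hsq (u : ℝ) : (|u| ^ q) ^ (2 / q) = u ^ 2 := by
    rw [← Real.rpow_mul (abs_nonneg u), mul_div_cancel₀ _ hq.ne', Real.rpow_two, sq_abs]
  have := (convexOn_rpow ((one_le_div hq).2 hq2)).2 (Set.mem_Ici.2 (by positivity : 0 ≤ |c| ^ q))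
    (Set.mem_Ici.2 (by positivity : 0 ≤ |d| ^ q)) hs0 (sub_nonneg.2 hs1) (by ring)
  simp only [smul_eq_mul] at this
  rwa [hsq, hsq, hy] at this

theorem Bc_lower_bound (p q : ℝ) (hp : 2 ≤ p) (hq : q = p / (p - 1)) :
    ∀ x₁ x₂ x₃ x₄ : ℝ, |x₁| ^ p ≤ x₃ → |x₂| ^ q ≤ x₄ →
      x₁ * x₂ + Real.sqrt ((x₃ ^ (2 / p) - x₁ ^ 2) * (x₄ ^ (2 / q) - x₂ ^ 2))
        ≤ Bc p x₁ x₂ x₃ x₄ := by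
  intro x₁ x₂ x₃ x₄ h₃ h₄
  have hp0 : 0 < p := by linarith
  have hpq : p.HolderConjugate q := (Real.holderConjugate_iff_eq_conjExponent (by linarith)).2 hq
  have hq0 : 0 < q := hpq.symm.pos
  have hq2 : q ≤ 2 := by rw [hq, div_le_iff₀ (by linarith)]; linarith
  have hx₃ : 0 ≤ x₃ := (by positivity : 0 ≤ |x₁| ^ p).trans h₃
  obtain ⟨X, hX0, rfl⟩ : ∃ X : ℝ, 0 ≤ X ∧ X ^ p = x₃ :=
    ⟨x₃ ^ p⁻¹, by positivity, Real.rpow_inv_rpow hx₃ hp0.ne'⟩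
  have hX2 : (X ^ p) ^ (2 / p) = X ^ 2 := by
    rw [← Real.rpow_mul hX0, mul_div_cancel₀ _ hp0.ne', Real.rpow_two]
  rw [hX2]
  have hx₁ : |x₁| ≤ X := (Real.rpow_le_rpow_iff (abs_nonneg _) hX0 hp0).1 h₃
  rcases hx₁.eq_or_lt with rfl | hlt
  · obtain ⟨C, -, hC⟩ := exists_two_point hq0 (s := 1 / 2) (by norm_num) (by norm_num) h₄
    rw [sq_abs, sub_self, zero_mul, Real.sqrt_zero]
    refine le_of_eq_of_le ?_ (two_point_le_Bc hpq (a := x₁) (b := x₁) (by norm_num) (by norm_num)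
      ?_ ?_ ?_ hC) <;> ring
  · have hXpos : 0 < X := (abs_nonneg _).trans_lt hlt
    obtain ⟨hl, hr⟩ := abs_lt.1 hlt
    obtain ⟨s, hs⟩ : ∃ s : ℝ, (2 * s - 1) * X = x₁ := ⟨(1 + x₁ / X) / 2, by field_simp; ring⟩
    have hs0 : 0 < s := by
      by_contra! h
      nlinarith
    have hs1 : s < 1 := by
      by_contra! h
      nlinarith
    obtain ⟨C, hC0, hC⟩ := exists_two_point hq0 hs0 hs1 h₄
    have hvar := rpow_two_div_le_two_point hq0 hq2 hs0.le hs1.le hC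
    have hs1' : 0 < 1 - s := sub_pos.2 hs1
    have hsqrt : Real.sqrt ((X ^ 2 - x₁ ^ 2) * (x₄ ^ (2 / q) - x₂ ^ 2))
        ≤ 2 * X * s * (1 - s) * C := by
      refine Real.sqrt_le_iff.2 ⟨by positivity, ?_⟩
      have hX : X ^ 2 - x₁ ^ 2 = 4 * s * (1 - s) * X ^ 2 := by rw [← hs]; ring
      rw [hX]
      calc 4 * s * (1 - s) * X ^ 2 * (x₄ ^ (2 / q) - x₂ ^ 2)
          ≤ 4 * s * (1 - s) * X ^ 2 * (s * (1 - s) * C ^ 2) := by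
            refine mul_le_mul_of_nonneg_left ?_ (by positivity)
            linarith
        _ = _ := by ring
    refine (add_le_add_right hsqrt _).trans (le_of_eq_of_le ?_ (two_point_le_Bc hpq (a := X)
      (b := -X) hs0.le hs1.le ?_ ?_ ?_ hC))
    · rw [← hs]; ring
    · rw [← hs]; ring
    · ring
    · rw [abs_neg, abs_of_pos hXpos]; ring
end

section
/- Fix p > 2 and let s₀ be the unique positive solution of (p−1)s^{p−2} + (p−2)s^{p−1} = 1. Define Q(t,s) = ( (s^p + t)(1+t)^{p−1} − (s−t)^p ) / ( t(1+s)^p ) for 0 < t ≤ s, and Q(0,s) = ( (p−1)s^p + 1 + p·s^{p−1} ) / (1+s)^p for s > 0. Then: (i) for every s > 0 and every t ∈ (0,s], Q(t,s) ≥ Q(0,s); and (ii) the function s ↦ Q(0,s) attains its minimum over (0,∞) exactly at s = s₀. Consequently, Q(t,s) ≥ Q(0,s₀) for all 0 < t ≤ s. -/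
/-- The function Q from Section 4 of the paper, extended to t = 0 by continuity. -/
noncomputable def Qfun (p t s : ℝ) : ℝ :=
  if t = 0 then ((p - 1) * s ^ p + 1 + p * s ^ (p - 1)) / (1 + s) ^ p
  else ((s ^ p + t) * (1 + t) ^ (p - 1) - (s - t) ^ p) / (t * (1 + s) ^ p)

theorem mul_rpow_sub_two_le {p s : ℝ} (hp : 2 < p) (hs : 0 < s) :
    p * s ^ (p - 2) ≤ (p - 2) * s ^ p + 2 := by
  have h := Real.geom_mean_le_arith_mean2_weighted (w₁ := (p - 2) / p) (w₂ := 2 / p)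
    (p₁ := s ^ p) (p₂ := 1) (by apply div_nonneg <;> linarith) (by positivity)
    (by positivity) zero_le_one (by field_simp; ring)
  rw [← Real.rpow_mul hs.le, Real.one_rpow, mul_one, mul_one,
    mul_div_cancel₀ (p - 2) (by linarith : p ≠ 0)] at h
  calc p * s ^ (p - 2) ≤ p * ((p - 2) / p * s ^ p + 2 / p) := by gcongr
    _ = (p - 2) * s ^ p + 2 := by field_simp

theorem mul_rpow_mul_rpow_le {p s t : ℝ} (hp : 2 < p) (ht : 0 ≤ t) (hts : t < s) :
    p * ((s - t) ^ (p - 2) * (1 + t) ^ (3 - p)) ≤ (p - 2) * s ^ p + 2 + p * t := by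
  have hs : 0 < s := ht.trans_lt hts
  rcases le_total p 3 with h3 | h3
  · have h := Real.geom_mean_le_arith_mean2_weighted (w₁ := p - 2) (w₂ := 3 - p)
      (p₁ := s - t) (p₂ := 1 + t) (by linarith) (by linarith) (by linarith) (by linarith)
      (by ring)
    have hb := one_add_mul_self_le_rpow_one_add (s := s - 1) (by linarith) (p := p) (by linarith)
    rw [add_sub_cancel] at hb
    have h1 := mul_le_mul_of_nonneg_left h (by linarith : 0 ≤ p)
    have h2 := mul_le_mul_of_nonneg_left hb (by linarith : 0 ≤ p - 2)
    have h4 : 0 ≤ p * (p - 2) * t := by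
      have : 0 < p - 2 := by linarith
      positivity
    nlinarith
  · have h1 : (s - t) ^ (p - 2) ≤ s ^ (p - 2) :=
      Real.rpow_le_rpow (by linarith) (by linarith) (by linarith)
    have h2 : (1 + t) ^ (3 - p) ≤ 1 :=
      Real.rpow_le_one_of_one_le_of_nonpos (by linarith) (by linarith)
    have h4 : (s - t) ^ (p - 2) * (1 + t) ^ (3 - p) ≤ s ^ (p - 2) * 1 := by gcongr
    have h5 := mul_le_mul_of_nonneg_left h4 (by linarith : 0 ≤ p)
    have h6 := mul_rpow_sub_two_le hp hs
    have h7 : 0 ≤ p * t := by positivity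
    linarith

/-- The numerator of `Qfun p t s` for `t ≠ 0` lies above its tangent line at `t = 0`. -/
theorem tangent_le_Qfun_numerator {p s t : ℝ} (hp : 2 < p) (ht : 0 < t) (hts : t ≤ s) :
    t * ((p - 1) * s ^ p + 1 + p * s ^ (p - 1)) ≤
      (s ^ p + t) * (1 + t) ^ (p - 1) - (s - t) ^ p := by
  set N : ℝ → ℝ := fun x => (s ^ p + x) * (1 + x) ^ (p - 1) - (s - x) ^ p with hN
  set N' : ℝ → ℝ := fun x => (1 + x) ^ (p - 1) + (s ^ p + x) * ((p - 1) * (1 + x) ^ (p - 2))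
    + p * (s - x) ^ (p - 1) with hN'
  have hs : 0 < s := ht.trans_le hts
  have dAdd (x q : ℝ) (hx : 0 ≤ x) :
      HasDerivAt (fun y : ℝ => (1 + y) ^ q) (q * (1 + x) ^ (q - 1)) x := by
    have := ((hasDerivAt_id x).const_add 1).rpow_const (p := q)
      (Or.inl (by simp only [id]; linarith))
    simpa using this
  have dSub (x q : ℝ) (hq : 1 ≤ q) :
      HasDerivAt (fun y : ℝ => (s - y) ^ q) (-(q * (s - x) ^ (q - 1))) x := by
    have := ((hasDerivAt_id x).const_sub s).rpow_const (p := q) (Or.inr hq)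
    simpa using this
  have dN (x : ℝ) (hx : 0 ≤ x) : HasDerivAt N (N' x) x := by
    have h := (((hasDerivAt_id x).const_add (s ^ p)).mul (dAdd x (p - 1) hx)).sub
      (dSub x p (by linarith))
    refine HasDerivAt.congr_deriv h ?_
    simp only [hN', id, show p - 1 - 1 = p - 2 by ring]
    ring
  have dN' (x : ℝ) (hx : 0 ≤ x) : HasDerivAt N' ((p - 1) * (1 + x) ^ (p - 2)
      + ((p - 1) * (1 + x) ^ (p - 2) + (s ^ p + x) * ((p - 1) * ((p - 2) * (1 + x) ^ (p - 3))))
      - p * ((p - 1) * (s - x) ^ (p - 2))) x := by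
    have h := ((dAdd x (p - 1) hx).add (((hasDerivAt_id x).const_add (s ^ p)).mul
      ((dAdd x (p - 2) hx).const_mul (p - 1)))).add ((dSub x (p - 1) (by linarith)).const_mul p)
    refine HasDerivAt.congr_deriv h ?_
    simp only [id, show p - 1 - 1 = p - 2 by ring, show p - 2 - 1 = p - 3 by ring]
    ring
  have mN' : MonotoneOn N' (Set.Icc 0 s) := by
    apply monotoneOn_of_deriv_nonneg (convex_Icc 0 s)
    · exact fun x hx => (dN' x hx.1).continuousAt.continuousWithinAt
    · rw [interior_Icc]
      exact fun x hx => (dN' x hx.1.le).differentiableAt.differentiableWithinAt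
    · rw [interior_Icc]
      intro x hx
      rw [(dN' x hx.1.le).deriv]
      have hx1 : 0 < 1 + x := by linarith [hx.1]
      have e1 : (1 + x) ^ (p - 2) = (1 + x) ^ (p - 3) * (1 + x) := by
        rw [← Real.rpow_add_one hx1.ne']; ring_nf
      have e2 : (1 + x) ^ (p - 3) * (1 + x) ^ (3 - p) = 1 := by
        rw [← Real.rpow_add hx1]; simp
      have key := mul_le_mul_of_nonneg_left (mul_rpow_mul_rpow_le hp hx.1.le hx.2)
        (by positivity : 0 ≤ (1 + x) ^ (p - 3))
      have e3 : (1 + x) ^ (p - 3) * (p * ((s - x) ^ (p - 2) * (1 + x) ^ (3 - p)))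
          = p * (s - x) ^ (p - 2) := by
        linear_combination p * (s - x) ^ (p - 2) * e2
      rw [e3] at key
      have key2 := mul_le_mul_of_nonneg_left key (by linarith : 0 ≤ p - 1)
      rw [e1]
      linarith
  have mono : MonotoneOn (fun x => N x - x * N' 0) (Set.Icc 0 s) := by
    have d (x : ℝ) (hx : 0 ≤ x) : HasDerivAt (fun x => N x - x * N' 0) (N' x - N' 0) x := by
      exact ((dN x hx).sub ((hasDerivAt_id x).mul_const (N' 0))).congr_deriv (by simp)
    apply monotoneOn_of_deriv_nonneg (convex_Icc 0 s)
    · exact fun x hx => (d x hx.1).continuousAt.continuousWithinAt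
    · rw [interior_Icc]
      exact fun x hx => (d x hx.1.le).differentiableAt.differentiableWithinAt
    · rw [interior_Icc]
      intro x hx
      rw [(d x hx.1.le).deriv]
      exact sub_nonneg.2 (mN' ⟨le_rfl, hs.le⟩ ⟨hx.1.le, hx.2.le⟩ hx.1.le)
  have h := mono ⟨le_rfl, hs.le⟩ ⟨ht.le, hts⟩ ht.le
  simp only [hN, hN', add_zero, sub_zero, zero_mul, Real.one_rpow, mul_one, sub_self] at h
  linarith

theorem Qfun_zero_le {p s t : ℝ} (hp : 2 < p) (ht : 0 < t) (hts : t ≤ s) :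
    Qfun p 0 s ≤ Qfun p t s := by
  have hs : 0 < 1 + s := by linarith
  rw [Qfun, Qfun, if_pos rfl, if_neg ht.ne', ← mul_div_mul_left _ _ ht.ne']
  gcongr
  exact tangent_le_Qfun_numerator hp ht hts

theorem hasDerivAt_Qfun_zero {p s : ℝ} (hs : 0 < s) :
    HasDerivAt (Qfun p 0)
      (p / (1 + s) ^ (p + 1) * ((p - 1) * s ^ (p - 2) + (p - 2) * s ^ (p - 1) - 1)) s := by
  have hs1 : 0 < 1 + s := by linarith
  have h1 := (((Real.hasDerivAt_rpow_const (p := p) (Or.inl hs.ne')).const_mul (p - 1)).add_const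
    1).add ((Real.hasDerivAt_rpow_const (p := p - 1) (Or.inl hs.ne')).const_mul p)
  have h2 := ((hasDerivAt_id s).const_add 1).rpow_const (p := p) (Or.inl hs1.ne')
  have h := h1.div h2 (Real.rpow_pos_of_pos hs1 p).ne'
  have hQ : Qfun p 0 = fun s => ((p - 1) * s ^ p + 1 + p * s ^ (p - 1)) / (1 + s) ^ p := by
    funext s
    exact if_pos rfl
  rw [hQ]
  refine HasDerivAt.congr_deriv h ?_
  have e1 : s ^ (p - 1) = s ^ (p - 2) * s := by
    rw [← Real.rpow_add_one hs.ne']; ring_nf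
  have e2 : s ^ p = s ^ (p - 2) * s * s := by
    rw [← e1, ← Real.rpow_add_one hs.ne']; ring_nf
  have e3 : (1 + s) ^ p = (1 + s) ^ (p - 1) * (1 + s) := by
    rw [← Real.rpow_add_one hs1.ne']; ring_nf
  have hpos : 0 < (1 + s) ^ (p - 1) := Real.rpow_pos_of_pos hs1 _
  simp only [id, Pi.add_apply, show p - 1 - 1 = p - 2 by ring]
  rw [Real.rpow_add_one hs1.ne', e3, e2, e1]
  field_simp
  ring

theorem strictMonoOn_rpow_combination {p : ℝ} (hp : 2 < p) :
    StrictMonoOn (fun s : ℝ => (p - 1) * s ^ (p - 2) + (p - 2) * s ^ (p - 1)) (Set.Ici 0) := by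
  intro a ha b _ hab
  have h1 := Real.rpow_lt_rpow ha hab (by linarith : 0 < p - 2)
  have h2 := Real.rpow_lt_rpow ha hab (by linarith : 0 < p - 1)
  exact add_lt_add (mul_lt_mul_of_pos_left h1 (by linarith))
    (mul_lt_mul_of_pos_left h2 (by linarith))

theorem Qfun_zero_lt {p s₀ s : ℝ} (hp : 2 < p) (hs₀pos : 0 < s₀)
    (hs₀ : (p - 1) * s₀ ^ (p - 2) + (p - 2) * s₀ ^ (p - 1) = 1) (hs : 0 < s) (hne : s ≠ s₀) :
    Qfun p 0 s₀ < Qfun p 0 s := by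
  have hcoef {x : ℝ} (hx : 0 < x) : 0 < p / (1 + x) ^ (p + 1) := by positivity
  rcases lt_or_gt_of_ne hne with h | h
  · have anti : StrictAntiOn (Qfun p 0) (Set.Icc s s₀) := by
      apply strictAntiOn_of_deriv_neg (convex_Icc s s₀)
      · exact fun x hx =>
          (hasDerivAt_Qfun_zero (hs.trans_le hx.1)).continuousAt.continuousWithinAt
      · rw [interior_Icc]
        intro x hx
        have hx0 : 0 < x := hs.trans hx.1
        rw [(hasDerivAt_Qfun_zero hx0).deriv]
        have := strictMonoOn_rpow_combination hp hx0.le hs₀pos.le hx.2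
        simp only [hs₀] at this
        exact mul_neg_of_pos_of_neg (hcoef hx0) (by linarith)
    exact anti ⟨le_rfl, h.le⟩ ⟨h.le, le_rfl⟩ h
  · have mono : StrictMonoOn (Qfun p 0) (Set.Icc s₀ s) := by
      apply strictMonoOn_of_deriv_pos (convex_Icc s₀ s)
      · exact fun x hx =>
          (hasDerivAt_Qfun_zero (hs₀pos.trans_le hx.1)).continuousAt.continuousWithinAt
      · rw [interior_Icc]
        intro x hx
        have hx0 : 0 < x := hs₀pos.trans hx.1
        rw [(hasDerivAt_Qfun_zero hx0).deriv]
        have := strictMonoOn_rpow_combination hp hs₀pos.le hx0.le hx.1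
        simp only [hs₀] at this
        exact mul_pos (hcoef hx0) (by linarith)
    exact mono ⟨le_rfl, h.le⟩ ⟨h.le, le_rfl⟩ h

theorem Q_min (p : ℝ) (hp : 2 < p) (s₀ : ℝ) (hs₀pos : 0 < s₀)
    (hs₀ : (p - 1) * s₀ ^ (p - 2) + (p - 2) * s₀ ^ (p - 1) = 1) :
    (∀ s : ℝ, 0 < s → ∀ t ∈ Set.Ioc (0 : ℝ) s, Qfun p 0 s ≤ Qfun p t s) ∧
    (∀ s : ℝ, 0 < s → Qfun p 0 s₀ ≤ Qfun p 0 s ∧ (Qfun p 0 s = Qfun p 0 s₀ → s = s₀)) ∧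
    (∀ s t : ℝ, 0 < t → t ≤ s → Qfun p 0 s₀ ≤ Qfun p t s) := by
  have hmin (s : ℝ) (hs : 0 < s) : Qfun p 0 s₀ ≤ Qfun p 0 s := by
    rcases eq_or_ne s s₀ with rfl | hne
    · exact le_rfl
    · exact (Qfun_zero_lt hp hs₀pos hs₀ hs hne).le
  refine ⟨fun s _ t ht => Qfun_zero_le hp ht.1 ht.2, fun s hs => ⟨hmin s hs, fun heq => ?_⟩,
    fun s t ht hts => (hmin s (ht.trans_le hts)).trans (Qfun_zero_le hp ht hts)⟩
  by_contra hne
  exact (Qfun_zero_lt hp hs₀pos hs₀ hs hne).ne' heq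
end
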